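/- arXiv:cs/0310065 — 6 statements merged into one kernel-verified Lean document; each statement's English description precedes it below -/
import Mathlib

section
/- Let T be a finite tree with positive edge weights, and let A and B be subtrees of T such that A ∪ B = T and A ∩ B consists of a single vertex c. If max_dist(A,c) ≥ max_dist(B,c), then every center of T is a vertex of A. -/
open SimpleGraph

/-- The maximal distance from `v` to a vertex of the set `S`, with respect to the
distance function `d` (supremum of a finite nonempty set of reals). -/
noncomputable def maxDist {V : Type*} (d : V → V → ℝ) (S : Set V) (v : V) : ℝ :=
  sSup (d v '' S)

theorem dist_le_maxDist {V : Type*} [Finite V] (d : V → V → ℝ) {S : Set V} (v : V) {u : V}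
    (hu : u ∈ S) : d v u ≤ maxDist d S v :=
  le_csSup (S.toFinite.image _).bddAbove ⟨u, hu, rfl⟩

theorem exists_dist_eq_maxDist {V : Type*} [Finite V] (d : V → V → ℝ) (S : Set V)
    (hS : S.Nonempty) (v : V) : ∃ u ∈ S, d v u = maxDist d S v :=
  (hS.image (d v)).csSup_mem (S.toFinite.image _)

theorem mem_verts_or_mem_verts_of_sup_eq_top {V : Type*} {T : SimpleGraph V} {A B : T.Subgraph}
    (h : A ⊔ B = ⊤) (v : V) : v ∈ A.verts ∨ v ∈ B.verts := by
  have hv : v ∈ (A ⊔ B).verts := h ▸ Set.mem_univ v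
  exact hv

/-- A walk entering `A` from outside passes through the only common vertex of `A` and `B`. -/
theorem mem_support_of_sup_eq_top {V : Type*} {T : SimpleGraph V} {A B : T.Subgraph}
    (hUnion : A ⊔ B = ⊤) {c : V} (hInter : (A ⊓ B).verts = {c}) {v a : V} (p : T.Walk v a)
    (hv : v ∉ A.verts) (ha : a ∈ A.verts) : c ∈ p.support := by
  induction p with
  | nil => exact absurd ha hv
  | @cons u w _ h q ih =>
    rw [Walk.support_cons]
    refine List.mem_cons_of_mem _ ?_
    by_cases hw : w ∈ A.verts
    · have hadj : (A ⊔ B).Adj u w := by rw [hUnion]; exact h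
      rcases hadj with hA | hB
      · exact absurd hA.fst_mem hv
      · have hwc : w ∈ (A ⊓ B).verts := ⟨hw, hB.snd_mem⟩
        rw [hInter, Set.mem_singleton_iff] at hwc
        exact hwc ▸ q.start_mem_support
    · exact ih hw ha

theorem sum_edges_pos {V : Type*} {T : SimpleGraph V} {ew : Sym2 V → ℝ}
    (hew : ∀ e ∈ T.edgeSet, 0 < ew e) {u v : V} (p : T.Walk u v) (huv : u ≠ v) :
    0 < (p.edges.map ew).sum := by
  refine List.sum_pos _ (fun x hx ↦ ?_) ?_
  · obtain ⟨e, he, rfl⟩ := List.mem_map.mp hx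
    exact hew e (p.edges_subset_edgeSet he)
  · cases p with
    | nil => exact absurd rfl huv
    | cons h q => simp

/-- Let `T` be a finite tree with positive edge weights, and let `A`, `B` be subtrees
(connected subgraphs) with `A ∪ B = T` and `A ∩ B = {c}`.  If
`max_dist(A,c) ≥ max_dist(B,c)`, then every center of `T` is a vertex of `A`. -/
theorem center_in_heavier_side {V : Type*} [Fintype V] (T : SimpleGraph V) (hT : T.IsTree)
    (ew : Sym2 V → ℝ) (hew : ∀ e ∈ T.edgeSet, 0 < ew e)
    (d : V → V → ℝ)
    (hd : ∀ (u v : V) (p : T.Path u v), d u v = ((p : T.Walk u v).edges.map ew).sum)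
    (A B : T.Subgraph) (hAconn : A.Connected) (hBconn : B.Connected)
    (hUnion : A ⊔ B = ⊤) (c : V) (hInter : (A ⊓ B).verts = {c})
    (hmax : maxDist d B.verts c ≤ maxDist d A.verts c)
    (v : V) (hcenter : ∀ u : V, maxDist d Set.univ v ≤ maxDist d Set.univ u) :
    v ∈ A.verts := by
  classical
  by_contra hvA
  have hcAB : c ∈ A.verts ∧ c ∈ B.verts := by
    have : c ∈ (A ⊓ B).verts := hInter ▸ rfl
    exact this
  have hvc : v ≠ c := fun h ↦ hvA (h ▸ hcAB.1)
  obtain ⟨a, haA, ha⟩ := exists_dist_eq_maxDist d A.verts ⟨c, hcAB.1⟩ c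
  have hc : maxDist d Set.univ c ≤ d c a := by
    obtain ⟨w, -, hw⟩ := exists_dist_eq_maxDist d Set.univ ⟨c, trivial⟩ c
    rw [← hw, ha]
    rcases mem_verts_or_mem_verts_of_sup_eq_top hUnion w with hwA | hwB
    · exact dist_le_maxDist d c hwA
    · exact (dist_le_maxDist d c hwB).trans hmax
  obtain ⟨p, hp⟩ := hT.connected.preconnected.exists_isPath v a
  have hcp := mem_support_of_sup_eq_top hUnion hInter p hvA haA
  have hsplit : d v a = d v c + d c a := by
    rw [hd v a ⟨p, hp⟩, hd v c ⟨_, hp.takeUntil hcp⟩, hd c a ⟨_, hp.dropUntil hcp⟩,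
      ← List.sum_append, ← List.map_append, ← Walk.edges_append, Walk.take_spec]
  have hpos : 0 < d v c := by
    rw [hd v c ⟨_, hp.takeUntil hcp⟩]
    exact sum_edges_pos hew _ hvc
  linarith [hcenter c, dist_le_maxDist d v (Set.mem_univ a)]
end

section
/- Let T be a finite tree with positive edge weights and positive vertex weights, let (v,w) be an edge of T, and let T_v and T_w be the two components of T with the edge (v,w) removed, containing v and w respectively. If vert_weight(T_v) = vert_weight(T_w), then v and w are medians of T and they are the only medians of T. -/
open SimpleGraph

/-- The median cost of vertex `m`: the sum over all vertices `u` of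
`weight(u) · dist(u,m)`. -/
noncomputable def medianCost {V : Type*} [Fintype V] (vw : V → ℝ) (d : V → V → ℝ)
    (m : V) : ℝ :=
  ∑ u : V, vw u * d u m

open Classical in
/-- The total vertex weight of the connected component of `x` in the graph `G`. -/
noncomputable def compWeight {V : Type*} [Fintype V] (G : SimpleGraph V) (vw : V → ℝ)
    (x : V) : ℝ :=
  ∑ u : V, if G.Reachable u x then vw u else 0

namespace SimpleGraph

variable {V : Type*} {G : SimpleGraph V} {ew : Sym2 V → ℝ} {d : V → V → ℝ} {v w : V}

/-- `G.IsPathWeight ew d` says that every path of `G` from `u` to `v` has total weight `d u v`. -/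
def IsPathWeight (G : SimpleGraph V) (ew : Sym2 V → ℝ) (d : V → V → ℝ) : Prop :=
  ∀ (u v : V) (p : G.Path u v), d u v = ((p : G.Walk u v).edges.map ew).sum

namespace IsPathWeight

theorem self_eq_zero (hd : G.IsPathWeight ew d) (v : V) : d v v = 0 := by
  simpa using hd v v Path.nil

theorem comm (hd : G.IsPathWeight ew d) (hG : G.Connected) (u v : V) : d u v = d v u := by
  classical
  obtain ⟨p⟩ := hG u v
  rw [hd u v p.toPath, hd v u p.toPath.reverse]
  simp

theorem pos (hd : G.IsPathWeight ew d) (hG : G.Connected) (hew : ∀ e ∈ G.edgeSet, 0 < ew e)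
    {u v : V} (huv : u ≠ v) : 0 < d u v := by
  classical
  obtain ⟨p⟩ := hG u v
  rw [hd u v p.toPath]
  refine List.sum_pos _ ?_ ?_
  · simp only [List.mem_map]
    rintro _ ⟨e, he, rfl⟩
    exact hew e (Walk.edges_subset_edgeSet _ he)
  · rw [Ne, List.map_eq_nil_iff, Walk.edges_eq_nil]
    exact fun h => huv h.eq

theorem le_walk_weight (hd : G.IsPathWeight ew d) (hew : ∀ e ∈ G.edgeSet, 0 < ew e)
    {u v : V} (p : G.Walk u v) : d u v ≤ (p.edges.map ew).sum := by
  classical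
  rw [hd u v p.toPath]
  refine (p.edges_bypass_sublist_edges.map ew).sum_le_sum ?_
  simp only [List.mem_map]
  rintro _ ⟨e, he, rfl⟩
  exact (hew e (p.edges_subset_edgeSet he)).le

theorem triangle (hd : G.IsPathWeight ew d) (hG : G.Connected)
    (hew : ∀ e ∈ G.edgeSet, 0 < ew e) (u v w : V) : d u w ≤ d u v + d v w := by
  classical
  obtain ⟨p⟩ := hG u v
  obtain ⟨q⟩ := hG v w
  have h := hd.le_walk_weight hew ((p.toPath : G.Walk u v).append (q.toPath : G.Walk v w))
  rwa [Walk.edges_append, List.map_append, List.sum_append, ← hd, ← hd] at h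

/-- A path between the two sides of a bridge crosses that bridge exactly once. -/
theorem eq_add_of_isBridge (hd : G.IsPathWeight ew d) (hadj : G.Adj v w)
    (hb : G.IsBridge s(v, w)) {a b : V} (ha : (G.deleteEdges {s(v, w)}).Reachable a v)
    (hbw : (G.deleteEdges {s(v, w)}).Reachable b w) :
    d a b = d a v + ew s(v, w) + d w b := by
  classical
  obtain ⟨p, hp⟩ := ha.exists_isPath
  obtain ⟨q, hq⟩ := hbw.symm.exists_isPath
  have hle := G.deleteEdges_le {s(v, w)}
  have hpath : ((p.mapLe hle).append (.cons hadj (q.mapLe hle))).IsPath := by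
    rw [Walk.isPath_def, Walk.support_append, Walk.support_cons, List.tail_cons,
      Walk.support_mapLe_eq_support, Walk.support_mapLe_eq_support, List.nodup_append']
    refine ⟨hp.support_nodup, hq.support_nodup, fun x hxp hxq => isBridge_iff.mp hb ?_⟩
    exact (p.dropUntil x hxp).reachable.symm.trans (q.takeUntil x hxq).reachable.symm
  have h₁ := hd a v ⟨_, hp.mapLe hle⟩
  have h₂ := hd w b ⟨_, hq.mapLe hle⟩
  rw [hd a b ⟨_, hpath⟩, h₁, h₂]
  simp [add_assoc]

end IsPathWeight

theorem Connected.reachable_deleteEdges_or (hG : G.Connected) (v w u : V) :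
    (G.deleteEdges {s(v, w)}).Reachable u v ∨ (G.deleteEdges {s(v, w)}).Reachable u w := by
  obtain ⟨p⟩ := hG u v
  induction p with
  | nil => exact .inl .rfl
  | @cons a b c hab p ih =>
    by_cases he : s(a, b) = s(c, w)
    · rcases Sym2.eq_iff.mp he with ⟨rfl, -⟩ | ⟨rfl, -⟩
      · exact .inl .rfl
      · exact .inr .rfl
    · have hr : (G.deleteEdges {s(c, w)}).Reachable a b :=
        (deleteEdges_adj.mpr ⟨hab, by simpa using he⟩).reachable
      exact ih.imp hr.trans hr.trans

/-- Every vertex on the side of `v` of a balanced bridge `s(v, w)` costs at least as much as `w`,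
with equality only at `v`. -/
theorem medianCost_le_of_reachable [Fintype V] {vw : V → ℝ} (hG : G.Connected)
    (hew : ∀ e ∈ G.edgeSet, 0 < ew e) (hvw : ∀ u, 0 < vw u) (hd : G.IsPathWeight ew d)
    (hadj : G.Adj v w) (hb : G.IsBridge s(v, w))
    (hbal : compWeight (G.deleteEdges {s(v, w)}) vw v
      = compWeight (G.deleteEdges {s(v, w)}) vw w)
    {m : V} (hm : (G.deleteEdges {s(v, w)}).Reachable m v) :
    medianCost vw d w ≤ medianCost vw d m ∧
      (m ≠ v → medianCost vw d w < medianCost vw d m) := by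
  classical
  set H := G.deleteEdges {s(v, w)}
  set g : V → ℝ := fun u => vw u * d u w +
    (ew s(v, w) + d v m) * ((if H.Reachable u w then vw u else 0) -
      (if H.Reachable u v then vw u else 0)) with hg
  have hnot : ¬ H.Reachable v w := isBridge_iff.mp hb
  have hsum : ∑ u, g u = medianCost vw d w := by
    unfold compWeight at hbal
    simp only [hg, Finset.sum_add_distrib, ← Finset.mul_sum, Finset.sum_sub_distrib, medianCost]
    rw [sub_eq_zero.mpr, mul_zero, add_zero]
    convert hbal.symm
  have hle : ∀ u, g u ≤ vw u * d u m := by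
    intro u
    have hside : H.Reachable u v ∨ H.Reachable u w := hG.reachable_deleteEdges_or v w u
    rcases hside with hu | hu
    · have huw : ¬ H.Reachable u w := fun h => hnot (hu.symm.trans h)
      have h₁ := hd.eq_add_of_isBridge hadj hb hu .rfl
      have h₂ := hd.triangle hG hew u m v
      rw [hd.self_eq_zero] at h₁
      rw [hd.comm hG m v] at h₂
      simp only [hg, if_pos hu, if_neg huw]
      nlinarith [hvw u]
    · have huv : ¬ H.Reachable u v := fun h => hnot (h.symm.trans hu)
      have h₁ := hd.eq_add_of_isBridge hadj hb hm hu
      rw [hd.comm hG m u, hd.comm hG m v, hd.comm hG w u] at h₁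
      simp only [hg, if_pos hu, if_neg huv, h₁]
      exact le_of_eq (by ring)
  rw [← hsum]
  refine ⟨Finset.sum_le_sum fun u _ => hle u, fun hmv => ?_⟩
  refine Finset.sum_lt_sum (fun u _ => hle u) ⟨v, Finset.mem_univ v, ?_⟩
  have h₁ := hd.eq_add_of_isBridge hadj hb (.refl v) (.refl w)
  rw [hd.self_eq_zero, hd.self_eq_zero] at h₁
  simp only [hg, if_pos (Reachable.refl v), if_neg hnot, h₁]
  nlinarith [mul_pos (hvw v) (hd.pos hG hew hmv.symm)]

end SimpleGraph

/-- Let `T` be a finite tree with positive edge and vertex weights, `(v,w)` an edge of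
`T`, and `T_v`, `T_w` the two components of `T` minus the edge `(v,w)`.  If
`vert_weight(T_v) = vert_weight(T_w)` then `v` and `w` are medians of `T` and they are
the only medians of `T`. -/
theorem medians_of_balanced_edge {V : Type*} [Fintype V]
    (T : SimpleGraph V) (hT : T.IsTree)
    (ew : Sym2 V → ℝ) (hew : ∀ e ∈ T.edgeSet, 0 < ew e)
    (vw : V → ℝ) (hvw : ∀ u : V, 0 < vw u)
    (d : V → V → ℝ)
    (hd : ∀ (u v : V) (p : T.Path u v), d u v = ((p : T.Walk u v).edges.map ew).sum)
    (v w : V) (hadj : T.Adj v w)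
    (hbal : compWeight (T.deleteEdges {s(v, w)}) vw v
          = compWeight (T.deleteEdges {s(v, w)}) vw w) :
    (∀ u : V, medianCost vw d v ≤ medianCost vw d u) ∧
    (∀ u : V, medianCost vw d w ≤ medianCost vw d u) ∧
    (∀ m : V, (∀ u : V, medianCost vw d m ≤ medianCost vw d u) → m = v ∨ m = w) := by
  have hb : T.IsBridge s(v, w) := isAcyclic_iff_forall_adj_isBridge.mp hT.isAcyclic hadj
  have hv {m : V} (hm : (T.deleteEdges {s(v, w)}).Reachable m v) :=
    medianCost_le_of_reachable hT.connected hew hvw hd hadj hb hbal hm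
  have hw {m : V} (hm : (T.deleteEdges {s(v, w)}).Reachable m w) :
      medianCost vw d v ≤ medianCost vw d m ∧
        (m ≠ w → medianCost vw d v < medianCost vw d m) := by
    rw [Sym2.eq_swap] at hm hb hbal
    exact medianCost_le_of_reachable hT.connected hew hvw hd hadj.symm hb hbal.symm hm
  have heq : medianCost vw d v = medianCost vw d w := le_antisymm (hw .rfl).1 (hv .rfl).1
  have hmin (u : V) : medianCost vw d v ≤ medianCost vw d u :=
    (hT.connected.reachable_deleteEdges_or v w u).elim (fun h => heq.trans_le (hv h).1)
      fun h => (hw h).1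
  refine ⟨hmin, fun u => heq.ge.trans (hmin u), fun m hm => ?_⟩
  rcases hT.connected.reachable_deleteEdges_or v w m with h | h
  · exact .inl (by_contra fun hne => ((hv h).2 hne).not_ge (hm w))
  · exact .inr (by_contra fun hne => ((hw h).2 hne).not_ge (hm v))
end

section
/- Let T be a finite tree with positive edge weights and positive vertex weights, let (v,w) be an edge of T, and let T_v and T_w be the two components of T with the edge (v,w) removed, containing v and w respectively. If vert_weight(T_v) > vert_weight(T_w), then every median of T is a vertex of T_v. -/
open SimpleGraph

/-- Deleting an edge of a connected graph leaves every vertex joined to an endpoint of that edge. -/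
theorem SimpleGraph.Walk.reachable_deleteEdges_or {V : Type*} {G : SimpleGraph V} {u v : V}
    (p : G.Walk u v) (w : V) :
    (G.deleteEdges {s(v, w)}).Reachable u v ∨ (G.deleteEdges {s(v, w)}).Reachable u w := by
  induction p with
  | nil => exact Or.inl (Reachable.refl _)
  | @cons a b c h p ih =>
    by_cases he : s(a, b) = s(c, w)
    · rcases Sym2.eq_iff.mp he with ⟨rfl, -⟩ | ⟨rfl, -⟩
      · exact Or.inl (Reachable.refl _)
      · exact Or.inr (Reachable.refl _)
    · have hab : (G.deleteEdges {s(c, w)}).Reachable a b :=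
        Adj.reachable (by simpa [deleteEdges_adj] using ⟨h, by simpa using he⟩)
      exact ih.imp hab.trans hab.trans

/-- A walk between vertices separated by deleting the edge `s(v, w)` visits `v`. -/
theorem SimpleGraph.Walk.mem_support_of_not_reachable_deleteEdges {V : Type*} {G : SimpleGraph V}
    {a b v w : V} (p : G.Walk a b) (h : ¬ (G.deleteEdges {s(v, w)}).Reachable a b) :
    v ∈ p.support := by
  by_contra hv
  refine h ⟨p.toDeleteEdges {s(v, w)} fun e he hmem => ?_⟩
  rw [Set.mem_singleton_iff] at hmem
  subst hmem
  exact hv (p.fst_mem_support_of_mem_edges he)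

/-- Bypassing the loops of a walk does not increase its weight. -/
theorem SimpleGraph.Walk.sum_edges_bypass_le {V : Type*} [DecidableEq V] {G : SimpleGraph V}
    {f : Sym2 V → ℝ} (hf : ∀ e ∈ G.edgeSet, 0 ≤ f e) {u v : V} (p : G.Walk u v) :
    (p.bypass.edges.map f).sum ≤ (p.edges.map f).sum := by
  refine (p.edges_bypass_sublist_edges.map f).sum_le_sum fun x hx => ?_
  obtain ⟨e, he, rfl⟩ := List.mem_map.mp hx
  exact hf e (p.edges_subset_edgeSet he)

/-- Let `T` be a finite tree with positive edge and vertex weights, `(v,w)` an edge of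
`T`, and `T_v`, `T_w` the two components of `T` minus the edge `(v,w)`.  If
`vert_weight(T_v) > vert_weight(T_w)` then every median of `T` is a vertex of `T_v`. -/
theorem median_in_heavier_component {V : Type*} [Fintype V]
    (T : SimpleGraph V) (hT : T.IsTree)
    (ew : Sym2 V → ℝ) (hew : ∀ e ∈ T.edgeSet, 0 < ew e)
    (vw : V → ℝ) (hvw : ∀ u : V, 0 < vw u)
    (d : V → V → ℝ)
    (hd : ∀ (u v : V) (p : T.Path u v), d u v = ((p : T.Walk u v).edges.map ew).sum)
    (v w : V) (hadj : T.Adj v w)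
    (hgt : compWeight (T.deleteEdges {s(v, w)}) vw v
         > compWeight (T.deleteEdges {s(v, w)}) vw w) :
    ∀ m : V, (∀ u : V, medianCost vw d m ≤ medianCost vw d u) →
      (T.deleteEdges {s(v, w)}).Reachable m v := by
  classical
  have hcon := hT.connected.preconnected
  have hpath : ∀ a b : V, ∃ p : T.Walk a b, p.IsPath := fun a b =>
    (hT.existsUnique_path a b).exists
  have hdist : ∀ {a b : V} {p : T.Walk a b}, p.IsPath → d a b = (p.edges.map ew).sum :=
    fun {a b p} hp => hd a b ⟨p, hp⟩
  have hsymm : ∀ a b, d a b = d b a := by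
    intro a b
    obtain ⟨p, hp⟩ := hpath a b
    rw [hdist hp, hdist hp.reverse, Walk.edges_reverse, List.map_reverse, List.sum_reverse]
  have hpos : ∀ a b, a ≠ b → 0 < d a b := by
    intro a b hab
    obtain ⟨p, hp⟩ := hpath a b
    rw [hdist hp]
    refine List.sum_pos _ (fun x hx => ?_) ?_
    · obtain ⟨e, he, rfl⟩ := List.mem_map.mp hx
      exact hew e (p.edges_subset_edgeSet he)
    · cases p with
      | nil => exact absurd rfl hab
      | cons h q => simp
  have htri : ∀ a b c, d a c ≤ d a b + d b c := by
    intro a b c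
    obtain ⟨p, hp⟩ := hpath a b
    obtain ⟨q, hq⟩ := hpath b c
    rw [hdist hp, hdist hq, hdist (p.append q).bypass_isPath, ← List.sum_append,
      ← List.map_append, ← Walk.edges_append]
    exact Walk.sum_edges_bypass_le (fun e he => (hew e he).le) _
  have hsplit : ∀ {a b c : V} {p : T.Walk a c}, p.IsPath → b ∈ p.support →
      d a c = d a b + d b c := by
    intro a b c p hp hb
    rw [hdist (hp.takeUntil hb), hdist (hp.dropUntil hb), hdist hp, ← List.sum_append,
      ← List.map_append, ← Walk.edges_append, Walk.take_spec]
  intro m hm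
  by_contra hmv
  have hD : 0 < d m v := hpos m v fun h => hmv (h ▸ Reachable.refl _)
  have hle : medianCost vw d v - medianCost vw d m ≤
      d m v * (compWeight (T.deleteEdges {s(v, w)}) vw w -
        compWeight (T.deleteEdges {s(v, w)}) vw v) := by
    unfold medianCost compWeight
    rw [← Finset.sum_sub_distrib, ← Finset.sum_sub_distrib, Finset.mul_sum]
    refine Finset.sum_le_sum fun u _ => ?_
    have hu := hvw u
    have hprod := mul_pos hD hu
    by_cases huv : (T.deleteEdges {s(v, w)}).Reachable u v
    · obtain ⟨p, hp⟩ := hpath u m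
      have hsum := hsplit hp
        (p.mem_support_of_not_reachable_deleteEdges fun h => hmv (h.symm.trans huv))
      rw [hsum, hsymm v m, if_pos huv]
      split_ifs <;> linarith
    · obtain ⟨p⟩ := hcon u v
      rw [if_pos ((p.reachable_deleteEdges_or w).resolve_left huv), if_neg huv]
      linarith [mul_le_mul_of_nonneg_left (htri u m v) hu.le]
  linarith [hm v, mul_pos hD (sub_pos.mpr hgt)]
end

section
/- Let T be a finite tree with positive edge weights and positive vertex weights, and let A and B be subtrees of T such that A ∪ B = T and A ∩ B consists of a single vertex c. If vert_weight(A) ≥ vert_weight(B), then A contains a median of T. -/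
open SimpleGraph

open Classical in
/-- The total vertex weight of a set `S` of vertices. -/
noncomputable def vertWeight {V : Type*} [Fintype V] (vw : V → ℝ) (S : Set V) : ℝ :=
  ∑ u : V, if u ∈ S then vw u else 0

namespace SimpleGraph

variable {V : Type*}

/-- A walk from `A` to `B`, where `A ⊔ B` is everything and `A ⊓ B` has `c` as its only vertex,
passes through `c`. -/
lemma Walk.mem_support_of_sup_eq_top {G : SimpleGraph V} {A B : G.Subgraph} (hU : A ⊔ B = ⊤)
    {c : V} (hI : (A ⊓ B).verts = {c}) {u v : V} (p : G.Walk u v) (hu : u ∈ A.verts)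
    (hv : v ∈ B.verts) : c ∈ p.support := by
  have eq_c {x : V} (hA : x ∈ A.verts) (hB : x ∈ B.verts) : x = c := by
    have hx : x ∈ (A ⊓ B).verts := ⟨hA, hB⟩
    rwa [hI] at hx
  induction p with
  | nil => simp [eq_c hu hv]
  | @cons u w v h p ih =>
    have hadj : (A ⊔ B).Adj u w := by rw [hU]; exact h
    rw [Subgraph.sup_adj] at hadj
    rcases hadj with hA | hB
    · exact List.mem_cons_of_mem _ (ih hA.snd_mem hv)
    · simp [eq_c hu hB.fst_mem]

lemma Walk.sum_map_edges_bypass_le [DecidableEq V] {G : SimpleGraph V} {ew : Sym2 V → ℝ}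
    (hew : ∀ e ∈ G.edgeSet, 0 ≤ ew e) {u v : V} (p : G.Walk u v) :
    (p.bypass.edges.map ew).sum ≤ (p.edges.map ew).sum := by
  obtain ⟨l, hperm, hsub⟩ : p.bypass.edges.Subperm p.edges :=
    List.subperm_of_subset p.bypass_isPath.isTrail.edges_nodup p.edges_bypass_subset_edges
  rw [← (hperm.map ew).sum_eq]
  refine (hsub.map ew).sum_le_sum fun x hx ↦ ?_
  obtain ⟨e, he, rfl⟩ := List.mem_map.mp hx
  exact hew e (p.edges_subset_edgeSet he)

section PathLength

variable {G : SimpleGraph V} {ew : Sym2 V → ℝ} {d : V → V → ℝ}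

lemma pathLength_comm (hG : G.Connected)
    (hd : ∀ (u v : V) (p : G.Path u v), d u v = ((p : G.Walk u v).edges.map ew).sum) (u v : V) :
    d u v = d v u := by
  obtain ⟨p, hp⟩ := hG.exists_isPath u v
  rw [hd u v ⟨p, hp⟩, hd v u ⟨p.reverse, hp.reverse⟩]
  simp [List.sum_reverse]

lemma pathLength_triangle (hG : G.Connected) (hew : ∀ e ∈ G.edgeSet, 0 ≤ ew e)
    (hd : ∀ (u v : V) (p : G.Path u v), d u v = ((p : G.Walk u v).edges.map ew).sum)
    (u v w : V) : d u w ≤ d u v + d v w := by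
  classical
  obtain ⟨p, hp⟩ := hG.exists_isPath u v
  obtain ⟨q, hq⟩ := hG.exists_isPath v w
  rw [hd u v ⟨p, hp⟩, hd v w ⟨q, hq⟩, hd u w ⟨_, (p.append q).bypass_isPath⟩]
  simpa using (p.append q).sum_map_edges_bypass_le hew

lemma pathLength_eq_add_of_mem_support
    (hd : ∀ (u v : V) (p : G.Path u v), d u v = ((p : G.Walk u v).edges.map ew).sum)
    {u v c : V} {p : G.Walk u v} (hp : p.IsPath) (hc : c ∈ p.support) :
    d u v = d u c + d c v := by
  classical
  rw [hd u v ⟨p, hp⟩, hd u c ⟨_, hp.takeUntil hc⟩, hd c v ⟨_, hp.dropUntil hc⟩,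
    ← List.sum_append, ← List.map_append, ← Walk.edges_append, Walk.take_spec]

lemma pathLength_nonneg (hG : G.Connected) (hew : ∀ e ∈ G.edgeSet, 0 ≤ ew e)
    (hd : ∀ (u v : V) (p : G.Path u v), d u v = ((p : G.Walk u v).edges.map ew).sum)
    (u v : V) : 0 ≤ d u v := by
  obtain ⟨p, hp⟩ := hG.exists_isPath u v
  rw [hd u v ⟨p, hp⟩]
  refine List.sum_nonneg fun x hx ↦ ?_
  obtain ⟨e, he, rfl⟩ := List.mem_map.mp hx
  exact hew e (p.edges_subset_edgeSet he)

end PathLength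

/-- Moving from the common vertex `c` into the lighter part `B` does not lower the median cost. -/
lemma medianCost_le_of_mem_lighter [Fintype V] {G : SimpleGraph V} (hG : G.Connected)
    {ew : Sym2 V → ℝ} (hew : ∀ e ∈ G.edgeSet, 0 ≤ ew e) {vw : V → ℝ} (hvw : ∀ u, 0 ≤ vw u)
    {d : V → V → ℝ}
    (hd : ∀ (u v : V) (p : G.Path u v), d u v = ((p : G.Walk u v).edges.map ew).sum)
    {A B : G.Subgraph} (hU : A ⊔ B = ⊤) {c : V} (hI : (A ⊓ B).verts = {c})
    (hge : vertWeight vw B.verts ≤ vertWeight vw A.verts) {b : V} (hb : b ∈ B.verts) :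
    medianCost vw d c ≤ medianCost vw d b := by
  classical
  have hcb : 0 ≤ d c b := pathLength_nonneg hG hew hd c b
  have key (u : V) : vw u * d u c + ((if u ∈ A.verts then vw u else 0) -
      (if u ∈ B.verts then vw u else 0)) * d c b ≤ vw u * d u b := by
    have hu := hvw u
    by_cases hA : u ∈ A.verts
    · obtain ⟨p, hp⟩ := hG.exists_isPath u b
      rw [pathLength_eq_add_of_mem_support hd hp (p.mem_support_of_sup_eq_top hU hI hA hb)]
      have := mul_nonneg hu hcb
      split_ifs <;> nlinarith
    · have hB : u ∈ B.verts := by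
        have h : u ∈ (A ⊔ B).verts := by rw [hU]; trivial
        exact h.resolve_left hA
      have h := mul_le_mul_of_nonneg_left (pathLength_triangle hG hew hd u b c) hu
      rw [pathLength_comm hG hd b c] at h
      rw [if_neg hA, if_pos hB]
      linarith
  have hsum := Finset.sum_le_sum fun u (_ : u ∈ Finset.univ) ↦ key u
  rw [Finset.sum_add_distrib, ← Finset.sum_mul, Finset.sum_sub_distrib] at hsum
  have hw := mul_nonneg (sub_nonneg.mpr hge) hcb
  unfold vertWeight at hw
  unfold medianCost
  linarith

end SimpleGraph

/-- Let `T` be a finite tree with positive edge and vertex weights, and let `A`, `B` be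
subtrees (connected subgraphs) with `A ∪ B = T` and `A ∩ B = {c}`.  If
`vert_weight(A) ≥ vert_weight(B)` then `A` contains a median of `T`. -/
theorem median_in_heavier_subtree {V : Type*} [Fintype V]
    (T : SimpleGraph V) (hT : T.IsTree)
    (ew : Sym2 V → ℝ) (hew : ∀ e ∈ T.edgeSet, 0 < ew e)
    (vw : V → ℝ) (hvw : ∀ u : V, 0 < vw u)
    (d : V → V → ℝ)
    (hd : ∀ (u v : V) (p : T.Path u v), d u v = ((p : T.Walk u v).edges.map ew).sum)
    (A B : T.Subgraph) (hAconn : A.Connected) (hBconn : B.Connected)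
    (hUnion : A ⊔ B = ⊤) (c : V) (hInter : (A ⊓ B).verts = {c})
    (hge : vertWeight vw B.verts ≤ vertWeight vw A.verts) :
    ∃ m ∈ A.verts, ∀ u : V, medianCost vw d m ≤ medianCost vw d u := by
  have hc : c ∈ (A ⊓ B).verts := by rw [hInter]; rfl
  obtain ⟨m, hm, hmin⟩ :=
    Set.exists_min_image A.verts (medianCost vw d) (Set.toFinite _) ⟨c, hc.1⟩
  refine ⟨m, hm, fun u ↦ ?_⟩
  have hu : u ∈ (A ⊔ B).verts := by rw [hUnion]; trivial
  rcases hu with hA | hB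
  · exact hmin u hA
  · exact (hmin c hc.1).trans <| medianCost_le_of_mem_lighter hT.connected
      (fun e he ↦ (hew e he).le) (fun v ↦ (hvw v).le) hd hUnion hInter hge hB
end

section
/- Let T be a finite tree with at least two vertices, positive edge weights, and positive vertex weights. Then the set of medians of T is either a single vertex or consists of exactly the two endpoints of some edge of T. -/
open SimpleGraph

/-- Extending a path by an edge that leaves its support adds that edge's weight to the
distance. -/
lemma dist_eq_add_of_notMem_support {V : Type*} {T : SimpleGraph V} {ew : Sym2 V → ℝ}
    {d : V → V → ℝ}
    (hd : ∀ (u v : V) (p : T.Path u v), d u v = ((p : T.Walk u v).edges.map ew).sum)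
    {u a b : V} {p : T.Walk u b} (hp : p.IsPath) (hba : T.Adj b a) (ha : a ∉ p.support) :
    d u a = d u b + ew s(b, a) := by
  rw [hd u a ⟨p.concat hba, hp.concat ha hba⟩, hd u b ⟨p, hp⟩]
  simp [Walk.edges_concat]

/-- In a tree, the distances from a fixed vertex to two adjacent vertices differ by exactly the
weight of the edge joining them. -/
lemma dist_eq_add_or_of_adj {V : Type*} {T : SimpleGraph V} (hT : T.IsTree) {ew : Sym2 V → ℝ}
    {d : V → V → ℝ}
    (hd : ∀ (u v : V) (p : T.Path u v), d u v = ((p : T.Walk u v).edges.map ew).sum)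
    (u : V) {a b : V} (hab : T.Adj a b) :
    d u a = d u b + ew s(a, b) ∨ d u b = d u a + ew s(a, b) := by
  obtain ⟨p, hp, -⟩ := hT.existsUnique_path u b
  obtain ⟨q, hq, -⟩ := hT.existsUnique_path u a
  by_cases ha : a ∈ p.support
  · have hb := hT.isAcyclic.ne_mem_support_of_support_of_adj_of_isPath hp hq hab.symm ha
    exact .inr (dist_eq_add_of_notMem_support hd hq hab hb)
  · rw [Sym2.eq_swap]
    exact .inl (dist_eq_add_of_notMem_support hd hp hab.symm ha)

/-- In a tree with positive edge and vertex weights, the slope of the median cost strictly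
increases along two consecutive edges. -/
lemma medianCost_slope_lt {V : Type*} [Fintype V] {T : SimpleGraph V} (hT : T.IsTree)
    {ew : Sym2 V → ℝ} (hew : ∀ e ∈ T.edgeSet, 0 < ew e)
    {vw : V → ℝ} (hvw : ∀ u : V, 0 < vw u) {d : V → V → ℝ}
    (hd : ∀ (u v : V) (p : T.Path u v), d u v = ((p : T.Walk u v).edges.map ew).sum)
    {a b c : V} (hab : T.Adj a b) (hbc : T.Adj b c) (hac : a ≠ c) :
    ew s(b, c) * (medianCost vw d b - medianCost vw d a) <
      ew s(a, b) * (medianCost vw d c - medianCost vw d b) := by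
  have hw₁ : 0 < ew s(a, b) := hew _ hab
  have hw₂ : 0 < ew s(b, c) := hew _ hbc
  have hswap : ew s(b, a) = ew s(a, b) := by rw [Sym2.eq_swap]
  simp only [medianCost, ← Finset.sum_sub_distrib, Finset.mul_sum]
  refine Finset.sum_lt_sum (fun u _ ↦ ?_) ⟨b, Finset.mem_univ b, ?_⟩
  · suffices ew s(b, c) * (d u b - d u a) ≤ ew s(a, b) * (d u c - d u b) by
      nlinarith [mul_le_mul_of_nonneg_left this (hvw u).le]
    obtain ⟨p, hp, -⟩ := hT.existsUnique_path u b
    by_cases ha : a ∈ p.support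
    · have hc : c ∉ p.support := fun hc ↦ hac <|
        (hT.isAcyclic.eq_penultimate_of_adj_end hp hab.symm ha).trans
          (hT.isAcyclic.eq_penultimate_of_adj_end hp hbc hc).symm
      have hc' := dist_eq_add_of_notMem_support hd hp hbc hc
      rcases dist_eq_add_or_of_adj hT hd u hab with h | h <;> rw [hc', h] <;>
        nlinarith [mul_pos hw₁ hw₂]
    · have ha' := dist_eq_add_of_notMem_support hd hp hab.symm ha
      rcases dist_eq_add_or_of_adj hT hd u hbc with h | h <;> rw [ha', h, hswap] <;>
        nlinarith [mul_pos hw₁ hw₂]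
  · have ha := dist_eq_add_of_notMem_support hd (Walk.IsPath.nil (u := b)) hab.symm
      (by simpa using hab.ne)
    have hc := dist_eq_add_of_notMem_support hd (Walk.IsPath.nil (u := b)) hbc
      (by simpa using hbc.ne')
    rw [ha, hc, hswap]
    nlinarith [mul_pos (hvw b) (mul_pos hw₁ hw₂)]

/-- Once the median cost does not decrease along an edge of a tree, it strictly increases along
the following edge. -/
lemma medianCost_lt_of_le {V : Type*} [Fintype V] {T : SimpleGraph V} (hT : T.IsTree)
    {ew : Sym2 V → ℝ} (hew : ∀ e ∈ T.edgeSet, 0 < ew e)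
    {vw : V → ℝ} (hvw : ∀ u : V, 0 < vw u) {d : V → V → ℝ}
    (hd : ∀ (u v : V) (p : T.Path u v), d u v = ((p : T.Walk u v).edges.map ew).sum)
    {a b c : V} (hab : T.Adj a b) (hbc : T.Adj b c) (hac : a ≠ c)
    (hle : medianCost vw d a ≤ medianCost vw d b) :
    medianCost vw d b < medianCost vw d c := by
  have h := medianCost_slope_lt hT hew hvw hd hab hbc hac
  have h₀ := mul_nonneg (hew s(b, c) hbc).le (sub_nonneg.mpr hle)
  exact sub_pos.mp (pos_of_mul_pos_right (h₀.trans_lt h) (hew s(a, b) hab).le)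

/-- Once the median cost does not decrease along an edge of a tree, it strictly increases along
every nontrivial path continuing that edge. -/
lemma medianCost_lt_of_isPath {V : Type*} [Fintype V] {T : SimpleGraph V} (hT : T.IsTree)
    {ew : Sym2 V → ℝ} (hew : ∀ e ∈ T.edgeSet, 0 < ew e)
    {vw : V → ℝ} (hvw : ∀ u : V, 0 < vw u) {d : V → V → ℝ}
    (hd : ∀ (u v : V) (p : T.Path u v), d u v = ((p : T.Walk u v).edges.map ew).sum)
    {b v : V} (p : T.Walk b v) (hp : p.IsPath) {a : V} (hab : T.Adj a b) (ha : a ∉ p.support)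
    (hle : medianCost vw d a ≤ medianCost vw d b) (hbv : b ≠ v) :
    medianCost vw d b < medianCost vw d v := by
  induction p generalizing a with
  | nil => exact absurd rfl hbv
  | @cons b c v hbc q ih =>
    rw [Walk.cons_isPath_iff] at hp
    rw [Walk.support_cons, List.mem_cons, not_or] at ha
    have hac : a ≠ c := fun h ↦ ha.2 (h ▸ q.start_mem_support)
    have hlt := medianCost_lt_of_le hT hew hvw hd hab hbc hac hle
    rcases eq_or_ne c v with rfl | hcv
    · exact hlt
    · exact hlt.trans (ih hp.1 hbc hp.2 hlt.le hcv)

/-- Distinct medians of a tree are adjacent. -/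
lemma adj_of_medians {V : Type*} [Fintype V] {T : SimpleGraph V} (hT : T.IsTree)
    {ew : Sym2 V → ℝ} (hew : ∀ e ∈ T.edgeSet, 0 < ew e)
    {vw : V → ℝ} (hvw : ∀ u : V, 0 < vw u) {d : V → V → ℝ}
    (hd : ∀ (u v : V) (p : T.Path u v), d u v = ((p : T.Walk u v).edges.map ew).sum)
    {m n : V} (hm : ∀ u, medianCost vw d m ≤ medianCost vw d u)
    (hn : ∀ u, medianCost vw d n ≤ medianCost vw d u) (hmn : m ≠ n) : T.Adj m n := by
  obtain ⟨p, hp, -⟩ := hT.existsUnique_path m n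
  cases p with
  | nil => exact absurd rfl hmn
  | @cons _ b _ hmb q =>
    rw [Walk.cons_isPath_iff] at hp
    rcases eq_or_ne b n with rfl | hbn
    · exact hmb
    · exact absurd (medianCost_lt_of_isPath hT hew hvw hd q hp.1 hmb hp.2 (hm b) hbn)
        (hn b).not_gt

/-- Let `T` be a finite tree with at least two vertices, positive edge weights and
positive vertex weights.  Then the set of medians of `T` is either a single vertex or
consists of exactly the two endpoints of some edge of `T`. -/
theorem median_set_structure {V : Type*} [Fintype V] [Nontrivial V]
    (T : SimpleGraph V) (hT : T.IsTree)
    (ew : Sym2 V → ℝ) (hew : ∀ e ∈ T.edgeSet, 0 < ew e)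
    (vw : V → ℝ) (hvw : ∀ u : V, 0 < vw u)
    (d : V → V → ℝ)
    (hd : ∀ (u v : V) (p : T.Path u v), d u v = ((p : T.Walk u v).edges.map ew).sum) :
    (∃ m : V, {x : V | ∀ u : V, medianCost vw d x ≤ medianCost vw d u} = {m}) ∨
    (∃ v w : V, T.Adj v w ∧
      {x : V | ∀ u : V, medianCost vw d x ≤ medianCost vw d u} = {v, w}) := by
  obtain ⟨m, hm⟩ := Finite.exists_min (medianCost vw d)
  by_cases huniq : ∃ n, n ≠ m ∧ ∀ u, medianCost vw d n ≤ medianCost vw d u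
  · obtain ⟨n, hnm, hn⟩ := huniq
    have hmn := adj_of_medians hT hew hvw hd hm hn hnm.symm
    refine .inr ⟨m, n, hmn, Set.ext fun x ↦ ⟨fun hx ↦ ?_, ?_⟩⟩
    · by_contra hx'
      simp only [Set.mem_insert_iff, Set.mem_singleton_iff, not_or] at hx'
      have hnx := adj_of_medians hT hew hvw hd hn hx (Ne.symm hx'.2)
      exact (medianCost_lt_of_le hT hew hvw hd hmn hnx (Ne.symm hx'.1) (hm n)).not_ge (hx n)
    · rintro (rfl | rfl)
      exacts [hm, hn]
  · refine .inl ⟨m, Set.ext fun x ↦ ⟨fun hx ↦ ?_, ?_⟩⟩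
    · by_contra hxm
      exact huniq ⟨x, hxm, hx⟩
    · rintro rfl
      exact hm
end

section
/- Let G be a finite connected simple graph with real edge weights, let T be a minimum spanning tree of G, let e = (v,w) be an edge of T, and suppose the graph G − e obtained by deleting e from G is still connected. Let T_v and T_w be the two components of T − e, and let f be an edge of G − e of minimum weight among edges with one endpoint in T_v and the other in T_w. Then the tree obtained from T by removing e and adding f is a minimum spanning tree of G − e. -/
open SimpleGraph

open Classical in
/-- The total edge weight of a graph `G` on a finite vertex type. -/
noncomputable def totalWeight {V : Type*} [Fintype V] (ew : Sym2 V → ℝ)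
    (G : SimpleGraph V) : ℝ :=
  ∑ e ∈ G.edgeFinset, ew e

/-- `T` is a minimum spanning tree of `G` with respect to edge weights `ew`. -/
def IsMST {V : Type*} [Fintype V] (G : SimpleGraph V) (ew : Sym2 V → ℝ)
    (T : SimpleGraph V) : Prop :=
  T ≤ G ∧ T.IsTree ∧
    ∀ T' : SimpleGraph V, T' ≤ G → T'.IsTree → totalWeight ew T ≤ totalWeight ew T'

/-- When an edge of a connected graph is deleted, every vertex stays connected to one of the
endpoints of that edge. -/
lemma SimpleGraph.Connected.reachable_deleteEdges_or_s15 {V : Type*} {S : SimpleGraph V}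
    (hS : S.Connected) (a b u : V) :
    (S.deleteEdges {s(a, b)}).Reachable u a ∨ (S.deleteEdges {s(a, b)}).Reachable u b := by
  obtain ⟨c, hc, ⟨p⟩⟩ : ∃ c, c = a ∧ S.Reachable u c := ⟨a, rfl, hS.preconnected u a⟩
  induction p with
  | nil => exact .inl (hc ▸ .rfl)
  | @cons u t _ h p ih =>
    by_cases hut : s(u, t) = s(a, b)
    · rcases Sym2.eq_iff.1 hut with ⟨h1, -⟩ | ⟨h1, -⟩
      · exact .inl (h1 ▸ .rfl)
      · exact .inr (h1 ▸ .rfl)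
    · have hadj : (S.deleteEdges {s(a, b)}).Adj u t := by simp [deleteEdges_adj, h, hut]
      exact (ih hc).imp hadj.reachable.trans hadj.reachable.trans

/-- Replacing an edge of a tree by an edge joining the two resulting components gives a tree. -/
lemma SimpleGraph.IsTree.deleteEdges_sup_fromEdgeSet {V : Type*} {S : SimpleGraph V}
    (hS : S.IsTree) {a b c d : V} (hcd : ¬ (S.deleteEdges {s(a, b)}).Reachable c d) :
    (S.deleteEdges {s(a, b)} ⊔ fromEdgeSet {s(c, d)}).IsTree := by
  refine ⟨?_, (hS.isAcyclic.anti (deleteEdges_le _)).sup_edge_of_not_reachable hcd⟩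
  have hne : c ≠ d := by
    rintro rfl
    exact hcd .rfl
  have hmono {p q : V} (h : (S.deleteEdges {s(a, b)}).Reachable p q) :
      (S.deleteEdges {s(a, b)} ⊔ fromEdgeSet {s(c, d)}).Reachable p q := h.mono le_sup_left
  have hadj : (S.deleteEdges {s(a, b)} ⊔ fromEdgeSet {s(c, d)}).Reachable c d :=
    Adj.reachable (by simp [hne])
  have hab : (S.deleteEdges {s(a, b)} ⊔ fromEdgeSet {s(c, d)}).Reachable a b := by
    rcases hS.connected.reachable_deleteEdges_or_s15 a b c with hc | hc <;>
      rcases hS.connected.reachable_deleteEdges_or_s15 a b d with hd | hd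
    · exact absurd (hc.trans hd.symm) hcd
    · exact (hmono hc).symm.trans (hadj.trans (hmono hd))
    · exact (hmono hd).symm.trans (hadj.symm.trans (hmono hc))
    · exact absurd (hc.trans hd.symm) hcd
  have hroot (u : V) : (S.deleteEdges {s(a, b)} ⊔ fromEdgeSet {s(c, d)}).Reachable u a :=
    (hS.connected.reachable_deleteEdges_or_s15 a b u).elim hmono fun h ↦ (hmono h).trans hab.symm
  have : Nonempty V := ⟨a⟩
  exact ⟨fun u t ↦ (hroot u).trans (hroot t).symm⟩

/-- The total weight does not depend on how the edge set is enumerated. -/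
lemma totalWeight_eq_sum_edgeFinset {V : Type*} [Fintype V] (ew : Sym2 V → ℝ)
    (S : SimpleGraph V) [Fintype S.edgeSet] :
    totalWeight ew S = ∑ e ∈ S.edgeFinset, ew e := by
  unfold totalWeight
  congr!

/-- The weight change caused by an edge replacement. -/
lemma totalWeight_deleteEdges_sup_fromEdgeSet {V : Type*} [Fintype V] (ew : Sym2 V → ℝ)
    {S : SimpleGraph V} {a b c d : V} (hab : S.Adj a b)
    (hcd : ¬ (S.deleteEdges {s(a, b)}).Reachable c d) :
    totalWeight ew (S.deleteEdges {s(a, b)} ⊔ fromEdgeSet {s(c, d)}) =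
      totalWeight ew S - ew s(a, b) + ew s(c, d) := by
  classical
  have hne : c ≠ d := by
    rintro rfl
    exact hcd .rfl
  have hedges : (S.deleteEdges {s(a, b)} ⊔ fromEdgeSet {s(c, d)}).edgeFinset =
      insert s(c, d) (S.edgeFinset.erase s(a, b)) := by
    ext e
    induction e with | _ p q
    simp only [mem_edgeFinset, mem_edgeSet, sup_adj, deleteEdges_adj, fromEdgeSet_adj,
      Set.mem_singleton_iff, Finset.mem_insert, Finset.mem_erase]
    constructor
    · tauto
    · rintro (h | h)
      · exact .inr ⟨h, by rintro rfl; simp [eq_comm] at h; grind⟩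
      · tauto
  have hnotMem : s(c, d) ∉ S.edgeFinset.erase s(a, b) := by
    intro h
    refine hcd (Adj.reachable ?_)
    simpa [deleteEdges_adj, and_comm] using h
  have hsum := Finset.sum_erase_add S.edgeFinset ew (a := s(a, b)) (by simpa using hab)
  rw [totalWeight_eq_sum_edgeFinset, totalWeight_eq_sum_edgeFinset, hedges,
    Finset.sum_insert hnotMem]
  linarith

/-- In a tree, the walk between two vertices separated by `s` uses an edge leaving `s` whose
deletion disconnects them. -/
lemma SimpleGraph.IsTree.exists_adj_not_reachable_deleteEdges {V : Type*} {S : SimpleGraph V}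
    (hS : S.IsTree) (s : Set V) {v w : V} (hv : v ∈ s) (hw : w ∉ s) :
    ∃ a b, S.Adj a b ∧ a ∈ s ∧ b ∉ s ∧ ¬ (S.deleteEdges {s(a, b)}).Reachable v w := by
  obtain ⟨p, hp, hunique⟩ := hS.existsUnique_path v w
  obtain ⟨d, hd, hfst, hsnd⟩ := p.exists_boundary_dart s hv hw
  refine ⟨d.fst, d.snd, d.adj, hfst, hsnd, fun h ↦ ?_⟩
  obtain ⟨q, hq⟩ := h.exists_isPath
  have hqp : q.mapLe (deleteEdges_le _) = p := hunique _ (hq.mapLe _)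
  have hmem : s(d.fst, d.snd) ∈ p.edges := List.mem_map_of_mem hd
  rw [← hqp, Walk.edges_mapLe_eq_edges] at hmem
  simpa [deleteEdges_adj] using q.adj_of_mem_edges hmem

/-- Let `G` be a finite connected simple graph with real edge weights, `T` a minimum
spanning tree of `G`, and `e = (v,w)` an edge of `T` such that `G − e` is still
connected.  Let `T_v` and `T_w` be the two components of `T − e` (the vertices
reachable from `v`, resp. `w`, in `T − e`), and let `f = (x,y)` be an edge of `G − e`
of minimum weight among the edges with one endpoint in `T_v` and the other in `T_w`.
Then the tree obtained from `T` by removing `e` and adding `f` is a minimum spanning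
tree of `G − e`. -/
theorem replacement_edge_gives_MST {V : Type*} [Fintype V]
    (G : SimpleGraph V) (hG : G.Connected) (ew : Sym2 V → ℝ)
    (T : SimpleGraph V) (hT : IsMST G ew T)
    (v w : V) (hvw : T.Adj v w)
    (hG' : (G.deleteEdges {s(v, w)}).Connected)
    (x y : V) (hxy : (G.deleteEdges {s(v, w)}).Adj x y)
    (hx : (T.deleteEdges {s(v, w)}).Reachable x v)
    (hy : (T.deleteEdges {s(v, w)}).Reachable y w)
    (hmin : ∀ x' y' : V, (G.deleteEdges {s(v, w)}).Adj x' y' →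
      (T.deleteEdges {s(v, w)}).Reachable x' v →
      (T.deleteEdges {s(v, w)}).Reachable y' w →
      ew s(x, y) ≤ ew s(x', y')) :
    IsMST (G.deleteEdges {s(v, w)}) ew
      (T.deleteEdges {s(v, w)} ⊔ fromEdgeSet {s(x, y)}) := by
  obtain ⟨hTG, hTree, hTmin⟩ := hT
  have hsep : ¬ (T.deleteEdges {s(v, w)}).Reachable v w :=
    isAcyclic_iff_forall_adj_isBridge.1 hTree.isAcyclic hvw
  have hsep' : ¬ (T.deleteEdges {s(v, w)}).Reachable x y :=
    fun h ↦ hsep (hx.symm.trans (h.trans hy))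
  refine ⟨sup_le (deleteEdges_mono hTG) ?_, hTree.deleteEdges_sup_fromEdgeSet hsep', ?_⟩
  · exact (edge_le_iff _).2 (.inr hxy)
  intro S hSG hS
  obtain ⟨a, b, hab, ha, hb, hSsep⟩ := hS.exists_adj_not_reachable_deleteEdges
    {u | (T.deleteEdges {s(v, w)}).Reachable u v} Reachable.rfl (fun h ↦ hsep (Reachable.symm h))
  have hle := hmin a b (hSG hab) ha
    ((hTree.connected.reachable_deleteEdges_or_s15 v w b).resolve_left hb)
  have hexch := hTmin (S.deleteEdges {s(a, b)} ⊔ fromEdgeSet {s(v, w)})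
    (sup_le ((deleteEdges_le _).trans (hSG.trans (deleteEdges_le _)))
      ((edge_le_iff _).2 (.inr (hTG hvw))))
    (hS.deleteEdges_sup_fromEdgeSet hSsep)
  rw [totalWeight_deleteEdges_sup_fromEdgeSet ew hab hSsep] at hexch
  rw [totalWeight_deleteEdges_sup_fromEdgeSet ew hvw hsep']
  linarith
end
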